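/- arXiv:2010.06832 — 2 statements merged into one kernel-verified Lean document; each statement's English description precedes it below -/
import Mathlib

section
/- Fix natural numbers n ≥ 1 and k ≥ 0. The number of symmetric type-(2n+1) tuples (ε, c) satisfying c̄_1 + c̄_2 + ⋯ + c̄_{2n} = k is equal to 2^n · C(n + k/2 − 1, k/2) if k is even, and equal to 0 if k is odd. -/
/-- A type-(2n+1) tuple: `ε = (ε_1, …, ε_{2n+1})` (0-indexed here) with every
`ε_i ∈ {1, −1}` and `ε_1 = 1`, together with integers `c = (c_1, …, c_{2n})`,
subject to the normalization that `c_i = 0` implies `ε_i = ε_{i+1}`. -/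
structure TypeTuple (n : ℕ) where
  eps : Fin (2 * n + 1) → ℤ
  c : Fin (2 * n) → ℤ
  eps_pm : ∀ i, eps i = 1 ∨ eps i = -1
  eps_zero : eps 0 = 1
  norm : ∀ i : Fin (2 * n), c i = 0 → eps i.castSucc = eps i.succ

/-- `ψ(i) = 1` if `ε_i · c_i < 0` and `0` otherwise. -/
def TypeTuple.psi {n : ℕ} (T : TypeTuple n) (i : Fin (2 * n)) : ℕ :=
  if T.eps i.castSucc * T.c i < 0 then 1 else 0

/-- `ψ̄(i) = 1` if `c_i · ε_{i+1} < 0` and `0` otherwise. -/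
def TypeTuple.psiBar {n : ℕ} (T : TypeTuple n) (i : Fin (2 * n)) : ℕ :=
  if T.c i * T.eps i.succ < 0 then 1 else 0

/-- `c̄_i = 2|c_i| − ψ(i) − ψ̄(i)` (a nonnegative integer). -/
def TypeTuple.cbar {n : ℕ} (T : TypeTuple n) (i : Fin (2 * n)) : ℕ :=
  2 * (T.c i).natAbs - T.psi i - T.psiBar i

/-- A type-(2n+1) tuple is symmetric if `ε_i = ε_{2n+2−i}` and `c_i = c_{2n+1−i}`. -/
def TypeTuple.Symm {n : ℕ} (T : TypeTuple n) : Prop :=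
  (∀ i, T.eps i = T.eps i.rev) ∧ (∀ i, T.c i = T.c i.rev)

/-- The entry `c` of a step starting at the sign `e`, recovered from the pair `(m, b)` of
its weight `m` and of the truth value `b` of `e * c < 0`. -/
def decodeStep (e : ℤ) (p : ℕ × Bool) : ℤ :=
  if p.2 then -(e * ((p.1 / 2 + 1 : ℕ) : ℤ)) else e * (((p.1 + 1) / 2 : ℕ) : ℤ)

/-- The weight of a step from the sign `e` to the sign `e'` with entry `c`. -/
def stepWeight (e c e' : ℤ) : ℕ :=
  2 * c.natAbs - (if e * c < 0 then 1 else 0) - (if c * e' < 0 then 1 else 0)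

lemma eq_mul_neg_one_pow_stepWeight {e c e' : ℤ} (he : e = 1 ∨ e = -1) (he' : e' = 1 ∨ e' = -1)
    (h : c = 0 → e = e') : e' = e * (-1) ^ stepWeight e c e' := by
  rw [neg_one_pow_eq_ite]
  unfold stepWeight
  rcases he with rfl | rfl <;> rcases he' with rfl | rfl <;>
    simp only [Nat.even_iff] <;> split_ifs <;> omega

lemma decodeStep_stepWeight {e c e' : ℤ} (he : e = 1 ∨ e = -1) (he' : e' = 1 ∨ e' = -1)
    (h : c = 0 → e = e') : decodeStep e (stepWeight e c e', decide (e * c < 0)) = c := by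
  unfold decodeStep stepWeight
  rcases he with rfl | rfl <;> rcases he' with rfl | rfl <;>
    simp only [decide_eq_true_eq] <;> split_ifs <;> omega

lemma stepWeight_decodeStep {e : ℤ} (he : e = 1 ∨ e = -1) (p : ℕ × Bool) :
    stepWeight e (decodeStep e p) (e * (-1) ^ p.1) = p.1 := by
  obtain ⟨m, b⟩ := p
  rw [neg_one_pow_eq_ite]
  unfold decodeStep stepWeight
  rcases he with rfl | rfl <;> cases b <;>
    simp only [Nat.even_iff] <;> split_ifs <;> simp at * <;> omega

lemma mul_decodeStep_neg_iff {e : ℤ} (he : e = 1 ∨ e = -1) (p : ℕ × Bool) :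
    e * decodeStep e p < 0 ↔ p.2 = true := by
  obtain ⟨m, b⟩ := p
  unfold decodeStep
  rcases he with rfl | rfl <;> cases b <;> simp <;> omega

lemma eq_mul_neg_one_pow_of_decodeStep_eq_zero {e : ℤ} (he : e = 1 ∨ e = -1) (p : ℕ × Bool)
    (h : decodeStep e p = 0) : e = e * (-1) ^ p.1 := by
  obtain ⟨m, b⟩ := p
  rw [neg_one_pow_eq_ite]
  unfold decodeStep at h
  rcases he with rfl | rfl <;> cases b <;>
    simp only [Nat.even_iff] <;> split_ifs <;> simp at * <;> omega

lemma stepWeight_symm (e c e' : ℤ) : stepWeight e c e' = stepWeight e' c e := by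
  unfold stepWeight
  rw [mul_comm c e', mul_comm e c]
  omega

lemma Fin.sum_univ_eq_two_mul_of_rev {n : ℕ} (f : Fin (2 * n) → ℕ) (hf : ∀ i, f i = f i.rev) :
    ∑ i, f i = 2 * ∑ i : Fin n, f ⟨i, by omega⟩ := by
  have key : ∀ N (hN : N = n + n) (f : Fin N → ℕ), (∀ i, f i = f i.rev) →
      ∑ i, f i = 2 * ∑ i : Fin n, f ⟨i, by omega⟩ := by
    rintro N rfl f hf
    rw [Fin.sum_univ_add, two_mul]
    congr 1
    rw [← Equiv.sum_comp Fin.revPerm]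
    refine Finset.sum_congr rfl fun i _ => ?_
    rw [hf]
    congr 1
    ext
    simp
    omega
  exact key _ (two_mul n) f hf

namespace TypeTuple

variable {n : ℕ}

lemma cbar_eq_stepWeight (T : TypeTuple n) (i : Fin (2 * n)) :
    T.cbar i = stepWeight (T.eps i.castSucc) (T.c i) (T.eps i.succ) := rfl

/-- The weights and the values of `ψ` along the first half of a tuple. -/
def halfCode (T : TypeTuple n) (i : Fin n) : ℕ × Bool :=
  (T.cbar ⟨i, by omega⟩,
    decide (T.eps (Fin.castSucc ⟨i, by omega⟩) * T.c ⟨i, by omega⟩ < 0))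

lemma Symm.cbar_rev {T : TypeTuple n} (hT : T.Symm) (i : Fin (2 * n)) :
    T.cbar i = T.cbar i.rev := by
  rw [cbar_eq_stepWeight, cbar_eq_stepWeight, stepWeight_symm, hT.2 i, hT.1 i.succ,
    hT.1 i.castSucc, Fin.rev_succ, Fin.rev_castSucc]

lemma Symm.sum_cbar {T : TypeTuple n} (hT : T.Symm) :
    ∑ i, T.cbar i = 2 * ∑ i, (T.halfCode i).1 :=
  Fin.sum_univ_eq_two_mul_of_rev _ hT.cbar_rev

lemma eps_succ (T : TypeTuple n) (i : Fin (2 * n)) :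
    T.eps i.succ = T.eps i.castSucc * (-1) ^ T.cbar i :=
  eq_mul_neg_one_pow_stepWeight (T.eps_pm _) (T.eps_pm _) (T.norm i)

lemma c_eq_decodeStep (T : TypeTuple n) (i : Fin n) :
    T.c ⟨i, by omega⟩ = decodeStep (T.eps (Fin.castSucc ⟨i, by omega⟩)) (T.halfCode i) :=
  (decodeStep_stepWeight (T.eps_pm _) (T.eps_pm _) (T.norm _)).symm

lemma Symm.eq_of_halfCode_eq {T U : TypeTuple n} (hT : T.Symm) (hU : U.Symm)
    (h : T.halfCode = U.halfCode) : T = U := by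
  have eps_half : ∀ j (hj : j ≤ n), T.eps ⟨j, by omega⟩ = U.eps ⟨j, by omega⟩ := by
    intro j
    induction j with
    | zero => intro _; exact T.eps_zero.trans U.eps_zero.symm
    | succ j ih =>
      intro hj
      have hw : T.cbar ⟨j, by omega⟩ = U.cbar ⟨j, by omega⟩ :=
        congrArg Prod.fst (congrFun h ⟨j, hj⟩)
      have h1 := T.eps_succ ⟨j, by omega⟩
      have h2 := U.eps_succ ⟨j, by omega⟩
      rw [← hw] at h2
      exact h1.trans ((congrArg (· * _) (ih (by omega))).trans h2.symm)
  have c_half : ∀ j (hj : j < n), T.c ⟨j, by omega⟩ = U.c ⟨j, by omega⟩ := by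
    intro j hj
    rw [T.c_eq_decodeStep ⟨j, hj⟩, U.c_eq_decodeStep ⟨j, hj⟩, h]
    exact congrArg (decodeStep · _) (eps_half j hj.le)
  have heps : T.eps = U.eps := by
    funext i
    rcases le_or_gt (i : ℕ) n with hi | hi
    · exact eps_half i hi
    · rw [hT.1, hU.1]
      exact eps_half i.rev (by rw [Fin.val_rev]; omega)
  have hc : T.c = U.c := by
    funext i
    rcases lt_or_ge (i : ℕ) n with hi | hi
    · exact c_half i hi
    · rw [hT.2, hU.2]
      exact c_half i.rev (by rw [Fin.val_rev]; omega)
  cases T; cases U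
  simp_all

/-- The sign reached after `j` steps whose weights are prescribed by `G`. -/
def signAt (G : ℕ → ℕ × Bool) (j : ℕ) : ℤ := (-1) ^ ∑ t ∈ Finset.range j, (G t).1

lemma signAt_eq_or (G : ℕ → ℕ × Bool) (j : ℕ) : signAt G j = 1 ∨ signAt G j = -1 :=
  neg_one_pow_eq_or ℤ _

lemma signAt_succ (G : ℕ → ℕ × Bool) (j : ℕ) :
    signAt G (j + 1) = signAt G j * (-1) ^ (G j).1 := by
  rw [signAt, Finset.sum_range_succ, pow_add, signAt]

lemma signAt_eq_of_decodeStep_eq_zero (G : ℕ → ℕ × Bool) (j : ℕ)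
    (h : decodeStep (signAt G j) (G j) = 0) : signAt G j = signAt G (j + 1) := by
  rw [signAt_succ]
  exact eq_mul_neg_one_pow_of_decodeStep_eq_zero (signAt_eq_or G j) _ h

/-- The symmetric tuple whose first half is decoded from the first `n` values of `G`. -/
def ofCode (n : ℕ) (G : ℕ → ℕ × Bool) : TypeTuple n where
  eps i := signAt G (min i (2 * n - i))
  c i := decodeStep (signAt G (min i (2 * n - 1 - i))) (G (min i (2 * n - 1 - i)))
  eps_pm _ := signAt_eq_or G _
  eps_zero := by simp [signAt]
  norm i h := by
    have hz := signAt_eq_of_decodeStep_eq_zero G _ h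
    simp only [Fin.val_castSucc, Fin.val_succ]
    rcases lt_or_ge (i : ℕ) n with hi | hi
    · rw [show min (i : ℕ) (2 * n - 1 - i) = i by omega] at hz
      rwa [show min (i : ℕ) (2 * n - i) = i by omega,
        show min ((i : ℕ) + 1) (2 * n - (i + 1)) = i + 1 by omega]
    · rw [show min (i : ℕ) (2 * n - 1 - i) = 2 * n - 1 - i by omega] at hz
      rw [show min (i : ℕ) (2 * n - i) = 2 * n - 1 - i + 1 by omega,
        show min ((i : ℕ) + 1) (2 * n - (i + 1)) = 2 * n - 1 - i by omega, hz]

lemma symm_ofCode (n : ℕ) (G : ℕ → ℕ × Bool) : (ofCode n G).Symm := by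
  constructor
  · intro i
    simp only [ofCode, Fin.val_rev]
    congr 1
    omega
  · intro i
    simp only [ofCode, Fin.val_rev]
    rw [show min (2 * n - ((i : ℕ) + 1)) (2 * n - 1 - (2 * n - ((i : ℕ) + 1))) =
      min (i : ℕ) (2 * n - 1 - i) by omega]

lemma halfCode_ofCode (n : ℕ) (G : ℕ → ℕ × Bool) (i : Fin n) :
    (ofCode n G).halfCode i = G i := by
  have he : (ofCode n G).eps (Fin.castSucc ⟨i, by omega⟩) = signAt G i := by
    simp only [ofCode, Fin.val_castSucc]
    congr 1
    omega
  have he' : (ofCode n G).eps (Fin.succ ⟨i, by omega⟩) = signAt G i * (-1) ^ (G i).1 := by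
    rw [← signAt_succ]
    simp only [ofCode, Fin.val_succ]
    congr 1
    omega
  have hc : (ofCode n G).c ⟨i, by omega⟩ = decodeStep (signAt G i) (G i) := by
    simp only [ofCode]
    rw [show min (i : ℕ) (2 * n - 1 - i) = i by omega]
  ext1
  · rw [halfCode, cbar_eq_stepWeight, he, he', hc]
    exact stepWeight_decodeStep (signAt_eq_or G i) _
  · rw [halfCode, he, hc]
    simp [mul_decodeStep_neg_iff (signAt_eq_or G i)]

lemma exists_symm_halfCode_eq (g : Fin n → ℕ × Bool) :
    ∃ T : TypeTuple n, T.Symm ∧ T.halfCode = g := by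
  refine ⟨ofCode n fun j => if h : j < n then g ⟨j, h⟩ else (0, false), symm_ofCode _ _, ?_⟩
  funext i
  simp [halfCode_ofCode]

/-- Symmetric tuples of total weight `k` correspond to half codes of total weight `k / 2`. -/
noncomputable def symmEquiv (n k : ℕ) :
    {T : TypeTuple n // T.Symm ∧ ∑ i, T.cbar i = k} ≃
      {g : Fin n → ℕ × Bool // 2 * ∑ i, (g i).1 = k} :=
  Equiv.ofBijective (fun T => ⟨T.1.halfCode, T.2.1.sum_cbar.symm.trans T.2.2⟩) <| by
    constructor
    · rintro ⟨T, hT, _⟩ ⟨U, hU, _⟩ h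
      exact Subtype.ext (hT.eq_of_halfCode_eq hU (congrArg Subtype.val h))
    · rintro ⟨g, hg⟩
      obtain ⟨T, hT, rfl⟩ := exists_symm_halfCode_eq g
      exact ⟨⟨T, hT, hT.sum_cbar.trans hg⟩, rfl⟩

end TypeTuple

lemma card_weighted_bool_functions (n m : ℕ) :
    Nat.card {g : Fin n → ℕ × Bool // ∑ i, (g i).1 = m} =
      2 ^ n * Nat.choose (n + m - 1) m := by
  let e : {g : Fin n → ℕ × Bool // ∑ i, (g i).1 = m} ≃
      {w : Fin n → ℕ // ∑ i, w i = m} × (Fin n → Bool) :=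
    { toFun g := (⟨fun i => (g.1 i).1, g.2⟩, fun i => (g.1 i).2)
      invFun p := ⟨fun i => (p.1.1 i, p.2 i), p.1.2⟩
      left_inv _ := rfl
      right_inv _ := rfl }
  rw [Nat.card_congr e, Nat.card_prod, Nat.card_congr (Sym.equivNatSumOfFintype (Fin n) m).symm,
    Nat.card_eq_fintype_card, Nat.card_eq_fintype_card, Sym.card_sym_eq_choose, mul_comm]
  simp

/-- The number of symmetric type-(2n+1) tuples with `∑ c̄_i = k` equals
`2^n · C(n + k/2 − 1, k/2)` if `k` is even and `0` if `k` is odd. -/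
theorem count_symmetric_type_tuples_by_sum (n k : ℕ) (hn : 1 ≤ n) :
    Nat.card {T : TypeTuple n // T.Symm ∧ ∑ i, T.cbar i = k} =
      if Even k then 2 ^ n * Nat.choose (n + k / 2 - 1) (k / 2) else 0 := by
  rw [Nat.card_congr (TypeTuple.symmEquiv n k)]
  split_ifs with hk
  · rw [← card_weighted_bool_functions]
    refine Nat.card_congr (Equiv.subtypeEquivRight fun g => ?_)
    rw [Nat.even_iff] at hk
    omega
  · have : IsEmpty {g : Fin n → ℕ × Bool // 2 * ∑ i, (g i).1 = k} :=
      ⟨fun g => hk (g.2 ▸ even_two_mul _)⟩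
    exact Nat.card_of_isEmpty
end

section
/- Fix natural numbers n ≥ 1 and t with 0 ≤ t ≤ n. The number of symmetric type-(2n+1) tuples (ε, c) such that exactly 2t of the entries c_1, …, c_{2n} are nonzero and c̄_1 + c̄_2 + ⋯ + c̄_{2n} = 0 is equal to C(n, t). -/
namespace TypeTuple

variable {n : ℕ}

theorem ext_of_eq {T U : TypeTuple n} (he : T.eps = U.eps) (hc : T.c = U.c) : T = U := by
  cases T; cases U; simp_all

/-- A vanishing `c̄_i` forces `ε_i = ε_{i+1}` and `c_i ∈ {0, -ε_i}`. -/
theorem eps_eq_and_c_of_cbar_eq_zero (T : TypeTuple n) (i : Fin (2 * n)) (h : T.cbar i = 0) :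
    T.eps i.castSucc = T.eps i.succ ∧ (T.c i = 0 ∨ T.c i = -T.eps i.castSucc) := by
  by_cases hc : T.c i = 0
  · exact ⟨T.norm i hc, Or.inl hc⟩
  · simp only [cbar, psi, psiBar] at h
    rcases T.eps_pm i.castSucc with h₁ | h₁ <;> rcases T.eps_pm i.succ with h₂ | h₂ <;>
      simp only [h₁, h₂, true_and] at h ⊢ <;> split_ifs at h <;> omega

theorem eps_eq_one (T : TypeTuple n) (h : ∀ i, T.cbar i = 0) (i : Fin (2 * n + 1)) :
    T.eps i = 1 := by
  induction i using Fin.induction with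
  | zero => exact T.eps_zero
  | succ i ih => rw [← (T.eps_eq_and_c_of_cbar_eq_zero i (h i)).1, ih]

/-- The map `Fin (2 * n) → Fin n` identifying each index with its mirror image. -/
def fold (i : Fin (2 * n)) : Fin n :=
  ⟨min i.val (2 * n - 1 - i.val), by omega⟩

/-- The inclusion of `Fin n` as the first half of `Fin (2 * n)`. -/
def firstHalf (k : Fin n) : Fin (2 * n) :=
  k.castLE (by omega)

@[simp]
theorem fold_firstHalf (k : Fin n) : fold (firstHalf k) = k := by
  ext; simp only [fold, firstHalf, Fin.val_castLE]; omega

@[simp]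
theorem fold_rev (i : Fin (2 * n)) : fold i.rev = fold i := by
  ext; simp only [fold, Fin.val_rev]; omega

theorem fold_eq_iff (i : Fin (2 * n)) (k : Fin n) :
    fold i = k ↔ i = firstHalf k ∨ i = (firstHalf k).rev := by
  simp only [fold, firstHalf, Fin.ext_iff, Fin.val_castLE, Fin.val_rev]; omega

theorem card_filter_fold_mem (S : Finset (Fin n)) :
    (Finset.univ.filter (fun i : Fin (2 * n) => fold i ∈ S)).card = 2 * S.card := by
  rw [Finset.card_eq_sum_card_fiberwise (f := fold) (t := S) (fun i hi => by simpa using hi)]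
  rw [mul_comm 2 S.card]
  refine Finset.sum_const_nat fun k hk => ?_
  have hfib : {i ∈ Finset.univ.filter (fun i : Fin (2 * n) => fold i ∈ S) | fold i = k} =
      {firstHalf k, (firstHalf k).rev} := by
    ext i
    simp only [Finset.mem_filter, Finset.mem_univ, true_and, Finset.mem_insert,
      Finset.mem_singleton, ← fold_eq_iff]
    exact ⟨fun h => h.2, fun h => ⟨h ▸ hk, h⟩⟩
  rw [hfib, Finset.card_pair]
  simp only [firstHalf, ne_eq, Fin.ext_iff, Fin.val_castLE, Fin.val_rev]
  omega

/-- The symmetric tuple with all signs `1` and with `c_i = -1` exactly over `S`. -/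
def ofFinset (S : Finset (Fin n)) : TypeTuple n where
  eps _ := 1
  c i := if fold i ∈ S then -1 else 0
  eps_pm _ := Or.inl rfl
  eps_zero := rfl
  norm _ _ := rfl

theorem ofFinset_c_ne_zero (S : Finset (Fin n)) (i : Fin (2 * n)) :
    (ofFinset S).c i ≠ 0 ↔ fold i ∈ S := by
  simp [ofFinset]

theorem ofFinset_injective : Function.Injective (ofFinset (n := n)) := by
  intro S U h
  ext k
  rw [← fold_firstHalf k, ← ofFinset_c_ne_zero, ← ofFinset_c_ne_zero, h]

theorem ofFinset_symm (S : Finset (Fin n)) : (ofFinset S).Symm :=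
  ⟨fun _ => rfl, fun i => by simp [ofFinset]⟩

theorem ofFinset_cbar (S : Finset (Fin n)) (i : Fin (2 * n)) : (ofFinset S).cbar i = 0 := by
  by_cases h : fold i ∈ S <;> simp [cbar, psi, psiBar, ofFinset, h]

theorem card_ofFinset_c_ne_zero (S : Finset (Fin n)) :
    (Finset.univ.filter (fun i => (ofFinset S).c i ≠ 0)).card = 2 * S.card := by
  simp only [ofFinset_c_ne_zero, card_filter_fold_mem]

theorem exists_eq_ofFinset (T : TypeTuple n) (hs : T.Symm) (h : ∀ i, T.cbar i = 0) :
    ∃ S, ofFinset S = T := by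
  refine ⟨Finset.univ.filter fun k => T.c (firstHalf k) ≠ 0, ext_of_eq ?_ ?_⟩
  · funext i
    exact (T.eps_eq_one h i).symm
  · funext i
    have hfold : T.c (firstHalf (fold i)) = T.c i := by
      rcases (fold_eq_iff i _).1 rfl with hi | hi
      · rw [← hi]
      · rw [hs.2, ← hi]
    have hc := (T.eps_eq_and_c_of_cbar_eq_zero i (h i)).2
    rw [T.eps_eq_one h] at hc
    rcases hc with hc | hc <;> simp [ofFinset, hfold, hc]

end TypeTuple

/-- The number of symmetric type-(2n+1) tuples with exactly `2t` nonzero `c_i`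
and `∑ c̄_i = 0` equals `C(n, t)`. -/
theorem count_symmetric_type_tuples_sum_zero (n t : ℕ) (hn : 1 ≤ n) (ht : t ≤ n) :
    Nat.card {T : TypeTuple n //
        T.Symm ∧ (Finset.univ.filter (fun i => T.c i ≠ 0)).card = 2 * t ∧
        ∑ i, T.cbar i = 0} =
      Nat.choose n t := by
  let f : Finset.powersetCard t (Finset.univ : Finset (Fin n)) → {T : TypeTuple n //
      T.Symm ∧ (Finset.univ.filter (fun i => T.c i ≠ 0)).card = 2 * t ∧
      ∑ i, T.cbar i = 0} := fun S =>
    ⟨TypeTuple.ofFinset S.1, TypeTuple.ofFinset_symm _,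
      by rw [TypeTuple.card_ofFinset_c_ne_zero, (Finset.mem_powersetCard.1 S.2).2],
      Finset.sum_eq_zero fun i _ => TypeTuple.ofFinset_cbar _ i⟩
  have hf : Function.Bijective f := by
    constructor
    · intro S U h
      exact Subtype.ext (TypeTuple.ofFinset_injective (congrArg Subtype.val h))
    · rintro ⟨T, hs, hcard, hsum⟩
      obtain ⟨S, rfl⟩ := T.exists_eq_ofFinset hs
        fun i => Finset.sum_eq_zero_iff.1 hsum i (Finset.mem_univ i)
      rw [TypeTuple.card_ofFinset_c_ne_zero] at hcard
      exact ⟨⟨S, Finset.mem_powersetCard.2 ⟨Finset.subset_univ S, by omega⟩⟩, rfl⟩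
  rw [← Nat.card_congr (Equiv.ofBijective f hf)]
  simp
end
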